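/- Let ξ > 0 and a < b be real numbers, and let g : ℝ → ℝ be four times continuously differentiable on a neighborhood of [a, b] and satisfy g⁗(t) − 2ξ² g″(t) + ξ⁴ g(t) = 0 for all t ∈ [a, b]. Then for every t ∈ [a, b], g(t) = (g″(a) − ξ² g(a))·A^{[1]}_{a,b}(t) + (g″(b) − ξ² g(b))·B^{[1]}_{a,b}(t) + g(a)·A^{[2]}_{a,b}(t) + g(b)·B^{[2]}_{a,b}(t). -/

import Mathlib

/-- `Φ_ξ(t) = (ξ t cosh(ξ t) − sinh(ξ t)) / (2 ξ³)`. -/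
noncomputable def Phi (ξ t : ℝ) : ℝ :=
  (ξ * t * Real.cosh (ξ * t) - Real.sinh (ξ * t)) / (2 * ξ ^ 3)

/-- `ψ_ξ(t) = sinh(ξ t) / ξ`. -/
noncomputable def psi (ξ t : ℝ) : ℝ := Real.sinh (ξ * t) / ξ

/-- `A^{[2]}_{a,b}(t) = sinh(ξ(t−b)) / sinh(ξ(a−b))`. -/
noncomputable def A2 (ξ a b t : ℝ) : ℝ :=
  Real.sinh (ξ * (t - b)) / Real.sinh (ξ * (a - b))

/-- `B^{[2]}_{a,b}(t) = sinh(ξ(t−a)) / sinh(ξ(b−a))`. -/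
noncomputable def B2 (ξ a b t : ℝ) : ℝ :=
  Real.sinh (ξ * (t - a)) / Real.sinh (ξ * (b - a))

/-- `A^{[1]}_{a,b}(t) = Φ_ξ(t−b)/ψ_ξ(a−b) − A^{[2]}_{a,b}(t)·Φ_ξ(a−b)/ψ_ξ(a−b)`. -/
noncomputable def A1 (ξ a b t : ℝ) : ℝ :=
  Phi ξ (t - b) / psi ξ (a - b) - A2 ξ a b t * (Phi ξ (a - b) / psi ξ (a - b))

/-- `B^{[1]}_{a,b}(t) = Φ_ξ(t−a)/ψ_ξ(b−a) − (Φ_ξ(b−a)/ψ_ξ(b−a))·B^{[2]}_{a,b}(t)`. -/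
noncomputable def B1 (ξ a b t : ℝ) : ℝ :=
  Phi ξ (t - a) / psi ξ (b - a) - Phi ξ (b - a) / psi ξ (b - a) * B2 ξ a b t

/-- `ρ(t) = (sinh(2ξt) − 2ξt) / (4ξ sinh²(ξt))`. -/
noncomputable def rho (ξ t : ℝ) : ℝ :=
  (Real.sinh (2 * ξ * t) - 2 * ξ * t) / (4 * ξ * Real.sinh (ξ * t) ^ 2)

/-- `σ(t) = (ξ t cosh(ξ t) − sinh(ξ t)) / (2ξ sinh²(ξt))`. -/
noncomputable def sigma (ξ t : ℝ) : ℝ :=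
  (ξ * t * Real.cosh (ξ * t) - Real.sinh (ξ * t)) / (2 * ξ * Real.sinh (ξ * t) ^ 2)

/-- A solution of `f'' = c f`, `c ≥ 0`, on `[a, b]` that vanishes at both endpoints is zero. -/
lemma eq_zero_of_second_deriv_eq_mul {a b c : ℝ} (hc : 0 ≤ c) {f f' : ℝ → ℝ}
    (hf : ∀ t ∈ Set.Icc a b, HasDerivAt f (f' t) t)
    (hf' : ∀ t ∈ Set.Icc a b, HasDerivAt f' (c * f t) t)
    (ha : f a = 0) (hb : f b = 0) : ∀ t ∈ Set.Icc a b, f t = 0 := by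
  have hprod : ∀ t ∈ Set.Icc a b,
      HasDerivAt (fun t => f t * f' t) (f' t * f' t + f t * (c * f t)) t :=
    fun t ht => (hf t ht).mul (hf' t ht)
  have hmono : MonotoneOn (fun t => f t * f' t) (Set.Icc a b) := by
    refine monotoneOn_of_deriv_nonneg (convex_Icc a b)
      (fun t ht => (hprod t ht).continuousAt.continuousWithinAt)
      (fun t ht => (hprod t (interior_subset ht)).differentiableAt.differentiableWithinAt)
      (fun t ht => ?_)
    rw [(hprod t (interior_subset ht)).deriv]
    nlinarith [mul_self_nonneg (f' t), mul_nonneg hc (mul_self_nonneg (f t))]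
  have hzero : ∀ t ∈ Set.Icc a b, f t * f' t = 0 := fun t ht => by
    have hab : a ≤ b := ht.1.trans ht.2
    have h₁ := hmono (Set.left_mem_Icc.2 hab) ht ht.1
    have h₂ := hmono ht (Set.right_mem_Icc.2 hab) ht.2
    simp only [ha, hb, zero_mul] at h₁ h₂
    exact le_antisymm h₂ h₁
  have hsq : ∀ t ∈ Set.Icc a b, HasDerivAt (fun t => f t * f t) 0 t := fun t ht => by
    refine ((hf t ht).mul (hf t ht)).congr_deriv ?_
    linear_combination 2 * hzero t ht
  intro t ht
  have hconst := constant_of_has_deriv_right_zero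
    (fun t ht => (hsq t ht).continuousAt.continuousWithinAt)
    (fun t ht => (hsq t (Set.Ico_subset_Icc_self ht)).hasDerivWithinAt) t ht
  simpa [ha] using hconst

lemma hasDerivAt_sinh_mul_sub (ξ c t : ℝ) :
    HasDerivAt (fun t => Real.sinh (ξ * (t - c))) (ξ * Real.cosh (ξ * (t - c))) t := by
  have h := (((hasDerivAt_id t).sub_const c).const_mul ξ).sinh
  simpa [mul_comm] using h

lemma hasDerivAt_cosh_mul_sub (ξ c t : ℝ) :
    HasDerivAt (fun t => Real.cosh (ξ * (t - c))) (ξ * Real.sinh (ξ * (t - c))) t := by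
  have h := (((hasDerivAt_id t).sub_const c).const_mul ξ).cosh
  simpa [mul_comm] using h

lemma hasDerivAt_Phi_sub {ξ : ℝ} (hξ : ξ ≠ 0) (c t : ℝ) :
    HasDerivAt (fun t => Phi ξ (t - c)) ((t - c) * Real.sinh (ξ * (t - c)) / (2 * ξ)) t := by
  have h := ((((((hasDerivAt_id t).sub_const c).const_mul ξ).mul
    (hasDerivAt_cosh_mul_sub ξ c t)).sub (hasDerivAt_sinh_mul_sub ξ c t)).div_const (2 * ξ ^ 3))
  refine h.congr_deriv ?_
  simp only [id]
  field_simp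
  ring

lemma hasDerivAt_deriv_Phi_sub {ξ : ℝ} (hξ : ξ ≠ 0) (c t : ℝ) :
    HasDerivAt (fun t => (t - c) * Real.sinh (ξ * (t - c)) / (2 * ξ))
      (ξ ^ 2 * Phi ξ (t - c) + psi ξ (t - c)) t := by
  have h := ((((hasDerivAt_id t).sub_const c).mul
    (hasDerivAt_sinh_mul_sub ξ c t)).div_const (2 * ξ))
  refine h.congr_deriv ?_
  simp only [id, Phi, psi]
  field_simp
  ring

/-- `A2 ξ a b` solves `f'' = ξ² f`. -/
lemma exists_deriv_A2 (ξ a b : ℝ) : ∃ f' : ℝ → ℝ, (∀ t, HasDerivAt (A2 ξ a b) (f' t) t) ∧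
    ∀ t, HasDerivAt f' (ξ ^ 2 * A2 ξ a b t) t := by
  refine ⟨_, fun t => (hasDerivAt_sinh_mul_sub ξ b t).div_const _, fun t =>
    (((hasDerivAt_cosh_mul_sub ξ b t).const_mul ξ).div_const _).congr_deriv ?_⟩
  simp only [A2]
  ring

lemma B2_eq_A2 (ξ a b : ℝ) : B2 ξ a b = A2 ξ b a := rfl

lemma B1_eq_A1 (ξ a b : ℝ) : B1 ξ a b = A1 ξ b a := by
  funext t
  simp only [B1, A1, B2_eq_A2]
  ring

/-- `A1 ξ a b` solves `f'' = ξ² f + A2 ξ a b`. -/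
lemma exists_deriv_A1 {ξ : ℝ} (hξ : ξ ≠ 0) (a b : ℝ) :
    ∃ f' : ℝ → ℝ, (∀ t, HasDerivAt (A1 ξ a b) (f' t) t) ∧
      ∀ t, HasDerivAt f' (ξ ^ 2 * A1 ξ a b t + A2 ξ a b t) t := by
  obtain ⟨p, hp, hp'⟩ := exists_deriv_A2 ξ a b
  refine ⟨_, fun t => ((hasDerivAt_Phi_sub hξ b t).div_const _).sub ((hp t).mul_const _), fun t =>
    (((hasDerivAt_deriv_Phi_sub hξ b t).div_const _).sub ((hp' t).mul_const _)).congr_deriv ?_⟩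
  have hA2 : A2 ξ a b t = psi ξ (t - b) / psi ξ (a - b) := by
    simp only [A2, psi]
    field_simp
  simp only [A1, hA2]
  ring

lemma A2_left {ξ a b : ℝ} (hξ : ξ ≠ 0) (hab : a ≠ b) : A2 ξ a b a = 1 :=
  div_self fun h => mul_ne_zero hξ (sub_ne_zero.2 hab) (Real.sinh_eq_zero.1 h)

lemma A2_right (ξ a b : ℝ) : A2 ξ a b b = 0 := by simp [A2]

lemma A1_left {ξ a b : ℝ} (hξ : ξ ≠ 0) (hab : a ≠ b) : A1 ξ a b a = 0 := by
  simp [A1, A2_left hξ hab]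

lemma A1_right (ξ a b : ℝ) : A1 ξ a b b = 0 := by simp [A1, A2_right, Phi]

/-- The iterated derivatives of a `C^n` function on an open set are differentiable below order
`n`. -/
lemma hasDerivAt_iterate_deriv {n : ℕ} {g : ℝ → ℝ} {U : Set ℝ} (hU : IsOpen U)
    (hg : ContDiffOn ℝ n g U) {k : ℕ} (hk : k < n) {t : ℝ} (ht : t ∈ U) :
    HasDerivAt (deriv^[k] g) (deriv^[k + 1] g t) t := by
  induction k generalizing n g with
  | zero =>
    exact ((hg.differentiableOn (by exact_mod_cast hk.ne')).differentiableAt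
      (hU.mem_nhds ht)).hasDerivAt
  | succ k ih =>
    obtain ⟨m, rfl⟩ : ∃ m, n = m + 1 := ⟨n - 1, by omega⟩
    exact ih (hg.deriv_of_isOpen hU (by norm_cast)) (by omega)

/-- A four times continuously differentiable solution of `L_ξ² g = 0` on a neighborhood
of `[a, b]` is reproduced on `[a, b]` by the basis functions `A1, B1, A2, B2`. -/
theorem spline_representation (ξ a b : ℝ) (hξ : 0 < ξ) (hab : a < b) (g : ℝ → ℝ)
    (U : Set ℝ) (hU : IsOpen U) (hUab : Set.Icc a b ⊆ U) (hg : ContDiffOn ℝ 4 g U)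
    (hode : ∀ t ∈ Set.Icc a b,
      deriv^[4] g t - 2 * ξ ^ 2 * deriv^[2] g t + ξ ^ 4 * g t = 0) :
    ∀ t ∈ Set.Icc a b,
      g t = (deriv^[2] g a - ξ ^ 2 * g a) * A1 ξ a b t
        + (deriv^[2] g b - ξ ^ 2 * g b) * B1 ξ a b t
        + g a * A2 ξ a b t + g b * B2 ξ a b t := by
  have hξ0 : ξ ≠ 0 := hξ.ne'
  have hg' : ContDiffOn ℝ (4 : ℕ) g U := by exact_mod_cast hg
  have hd : ∀ k < 4, ∀ t ∈ Set.Icc a b, HasDerivAt (deriv^[k] g) (deriv^[k + 1] g t) t :=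
    fun k hk t ht => hasDerivAt_iterate_deriv hU hg' hk (hUab ht)
  obtain ⟨p, hp, hp'⟩ := exists_deriv_A2 ξ a b
  obtain ⟨q, hq, hq'⟩ := exists_deriv_A2 ξ b a
  obtain ⟨r, hr, hr'⟩ := exists_deriv_A1 hξ0 a b
  obtain ⟨s, hs, hs'⟩ := exists_deriv_A1 hξ0 b a
  rw [B1_eq_A1, B2_eq_A2]
  set α := deriv^[2] g a - ξ ^ 2 * g a with hα
  set β := deriv^[2] g b - ξ ^ 2 * g b with hβ
  have hsecond : ∀ t ∈ Set.Icc a b,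
      deriv^[2] g t - ξ ^ 2 * g t - (α * A2 ξ a b t + β * A2 ξ b a t) = 0 := by
    refine eq_zero_of_second_deriv_eq_mul (sq_nonneg ξ)
      (fun t ht => ((hd 2 (by norm_num) t ht).sub ((hd 0 (by norm_num) t ht).const_mul _)).sub
        (((hp t).const_mul α).add ((hq t).const_mul β)))
      (fun t ht => (((hd 3 (by norm_num) t ht).sub ((hd 1 (by norm_num) t ht).const_mul _)).sub
        (((hp' t).const_mul α).add ((hq' t).const_mul β))).congr_deriv ?_) ?_ ?_
    · linear_combination hode t ht
    · rw [A2_left hξ0 hab.ne, A2_right, hα]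
      ring
    · rw [A2_left hξ0 hab.ne', A2_right, hβ]
      ring
  have hdiff : ∀ t ∈ Set.Icc a b,
      g t - (α * A1 ξ a b t + β * A1 ξ b a t + g a * A2 ξ a b t + g b * A2 ξ b a t) = 0 := by
    refine eq_zero_of_second_deriv_eq_mul (sq_nonneg ξ)
      (fun t ht => (hd 0 (by norm_num) t ht).sub
        (((((hr t).const_mul α).add ((hs t).const_mul β)).add
          ((hp t).const_mul (g a))).add ((hq t).const_mul (g b))))
      (fun t ht => ((hd 1 (by norm_num) t ht).sub
        (((((hr' t).const_mul α).add ((hs' t).const_mul β)).add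
          ((hp' t).const_mul (g a))).add ((hq' t).const_mul (g b)))).congr_deriv ?_) ?_ ?_
    · linear_combination hsecond t ht
    · rw [A1_left hξ0 hab.ne, A1_right, A2_left hξ0 hab.ne, A2_right]
      ring
    · rw [A1_left hξ0 hab.ne', A1_right, A2_left hξ0 hab.ne', A2_right]
      ring
  exact fun t ht => sub_eq_zero.1 (hdiff t ht)
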